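/- arXiv:2012.14883 — 2 statements merged into one kernel-verified Lean document; each statement's English description precedes it below -/
import Mathlib

section
/- Let A, B, C, D, E, F be six pairwise distinct points lying on a circle in the Euclidean plane ℝ². Suppose X is a point lying on both the line through A and B and the line through D and E; Y is a point lying on both the line through B and C and the line through E and F; and Z is a point lying on both the line through C and D and the line through F and A. Then X, Y and Z are collinear. -/
open scoped ComplexConjugate in
/-- A point on the chord through `a` and `b` of the unit circle satisfies `x + a b x̄ = a + b`. -/
theorem chord_equation {a b : ℂ} (ha : a * conj a = 1) (hb : b * conj b = 1) (t : ℝ) :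
    (a + t * (b - a)) + a * b * conj (a + t * (b - a)) = a + b := by
  simp only [map_add, map_mul, map_sub, Complex.conj_ofReal]
  linear_combination (b * (1 - t)) * ha + (a * t) * hb

/-- If two chord equations have a common solution and `a` is an endpoint of only the first chord,
then the products of the endpoints differ. -/
theorem mul_ne_mul_of_chord_equations {a b d e x y : ℂ} (had : a ≠ d) (hae : a ≠ e)
    (h₁ : x + a * b * y = a + b) (h₂ : x + d * e * y = d + e) : a * b - d * e ≠ 0 := by
  intro h
  have hs : a + b = d + e := by linear_combination h₂ - h₁ + y * h
  have hprod : (a - d) * (a - e) = 0 := by linear_combination a * hs - h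
  rcases mul_eq_zero.mp hprod with h' | h'
  · exact had (sub_eq_zero.mp h')
  · exact hae (sub_eq_zero.mp h')

/-- The algebraic form of Pascal's theorem, where a point is represented by a complex number `x`
together with its conjugate `x'`. -/
theorem pascal_determinant {a b c d e f x x' y y' z z' : ℂ}
    (hp : a * b - d * e ≠ 0) (hq : b * c - e * f ≠ 0) (hs : c * d - f * a ≠ 0)
    (hx₁ : x + a * b * x' = a + b) (hx₂ : x + d * e * x' = d + e)
    (hy₁ : y + b * c * y' = b + c) (hy₂ : y + e * f * y' = e + f)
    (hz₁ : z + c * d * z' = c + d) (hz₂ : z + f * a * z' = f + a) :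
    (y - x) * (z' - x') - (y' - x') * (z - x) = 0 := by
  have ex' : (a * b - d * e) * x' = a + b - d - e := by linear_combination hx₁ - hx₂
  have ey' : (b * c - e * f) * y' = b + c - e - f := by linear_combination hy₁ - hy₂
  have ez' : (c * d - f * a) * z' = c + d - f - a := by linear_combination hz₁ - hz₂
  have ex : (a * b - d * e) * x = a * b * (d + e) - d * e * (a + b) := by
    linear_combination a * b * hx₂ - d * e * hx₁
  have ey : (b * c - e * f) * y = b * c * (e + f) - e * f * (b + c) := by
    linear_combination b * c * hy₂ - e * f * hy₁
  have ez : (c * d - f * a) * z = c * d * (f + a) - f * a * (c + d) := by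
    linear_combination c * d * hz₂ - f * a * hz₁
  have expand : ∀ p q s : ℂ, p * q * s * ((y - x) * (z' - x') - (y' - x') * (z - x)) =
      p * ((q * y) * (s * z') - (q * y') * (s * z)) - q * ((p * x) * (s * z') - (p * x') * (s * z))
        + s * ((p * x) * (q * y') - (p * x') * (q * y)) := fun p q s => by ring
  refine (mul_eq_zero.mp ?_).resolve_left (mul_ne_zero (mul_ne_zero hp hq) hs)
  rw [expand, ex, ey, ez, ex', ey', ez']
  ring

/-- Three points of the Euclidean plane are collinear if the determinant of their coordinate
differences vanishes. -/
theorem collinear_of_det_eq_zero {X Y Z : EuclideanSpace ℝ (Fin 2)}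
    (h : (Y 0 - X 0) * (Z 1 - X 1) - (Y 1 - X 1) * (Z 0 - X 0) = 0) :
    Collinear ℝ ({X, Y, Z} : Set (EuclideanSpace ℝ (Fin 2))) := by
  rcases eq_or_ne X Y with rfl | hne
  · simpa using collinear_pair ℝ X Z
  have key : ∃ t : ℝ, Z = t • (Y - X) + X := by
    by_cases h0 : Y 0 - X 0 = 0
    · have h1 : Y 1 - X 1 ≠ 0 := by
        intro h1
        apply hne
        ext i
        fin_cases i
        · exact (sub_eq_zero.mp h0).symm
        · exact (sub_eq_zero.mp h1).symm
      refine ⟨(Z 1 - X 1) / (Y 1 - X 1), ?_⟩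
      ext i
      fin_cases i
      · simp
        field_simp
        linear_combination -h
      · simp
        field_simp
        ring
    · refine ⟨(Z 0 - X 0) / (Y 0 - X 0), ?_⟩
      ext i
      fin_cases i
      · simp
        field_simp
        ring
      · simp
        field_simp
        linear_combination h
  obtain ⟨t, ht⟩ := key
  rw [collinear_iff_of_mem (p₀ := X) (by simp)]
  refine ⟨Y - X, ?_⟩
  rintro p (rfl | rfl | rfl)
  · exact ⟨0, by simp⟩
  · exact ⟨1, by simp⟩
  · exact ⟨t, by simpa using ht⟩

/-- The complex coordinate of a point of the plane in which the circle with centre `O` and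
radius `r` becomes the unit circle. -/
noncomputable def circleCoord (O : EuclideanSpace ℝ (Fin 2)) (r : ℝ)
    (P : EuclideanSpace ℝ (Fin 2)) : ℂ :=
  ⟨(P 0 - O 0) / r, (P 1 - O 1) / r⟩

theorem circleCoord_injective (O : EuclideanSpace ℝ (Fin 2)) {r : ℝ} (hr : 0 < r) :
    Function.Injective (circleCoord O r) := by
  intro P Q h
  have h0 := congrArg Complex.re h
  have h1 := congrArg Complex.im h
  simp only [circleCoord, div_left_inj' hr.ne', sub_left_inj] at h0 h1
  ext i
  fin_cases i
  · exact h0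
  · exact h1

open scoped ComplexConjugate in
theorem circleCoord_mul_conj {O P : EuclideanSpace ℝ (Fin 2)} {r : ℝ} (hr : 0 < r)
    (hP : P ∈ Metric.sphere O r) : circleCoord O r P * conj (circleCoord O r P) = 1 := by
  have h : (P 0 - O 0) ^ 2 + (P 1 - O 1) ^ 2 = r ^ 2 := by
    rw [← Metric.mem_sphere.mp hP, EuclideanSpace.dist_sq_eq]
    simp [Fin.sum_univ_two, Real.dist_eq]
  rw [Complex.mul_conj, ← Complex.ofReal_one, Complex.ofReal_inj, Complex.normSq_apply]
  simp only [circleCoord]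
  field_simp
  linear_combination h

open scoped ComplexConjugate in
theorem circleCoord_chord_equation {O P Q X : EuclideanSpace ℝ (Fin 2)} {r : ℝ} (hr : 0 < r)
    (hP : P ∈ Metric.sphere O r) (hQ : Q ∈ Metric.sphere O r)
    (hX : X ∈ affineSpan ℝ ({P, Q} : Set (EuclideanSpace ℝ (Fin 2)))) :
    circleCoord O r X + circleCoord O r P * circleCoord O r Q * conj (circleCoord O r X) =
      circleCoord O r P + circleCoord O r Q := by
  obtain ⟨t, rfl⟩ := mem_affineSpan_pair_iff_exists_lineMap_eq.mp hX
  have h : circleCoord O r (AffineMap.lineMap P Q t) =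
      circleCoord O r P + t * (circleCoord O r Q - circleCoord O r P) := by
    apply Complex.ext <;> simp [circleCoord, AffineMap.lineMap_apply] <;> ring
  rw [h]
  exact chord_equation (circleCoord_mul_conj hr hP) (circleCoord_mul_conj hr hQ) t


/-- **Pascal's Theorem.** If `A, B, C, D, E, F` are six pairwise distinct points on a
circle in the Euclidean plane, `X` lies on lines `AB` and `DE`, `Y` on lines `BC` and `EF`,
and `Z` on lines `CD` and `FA`, then `X`, `Y`, `Z` are collinear. -/
theorem pascal_hexagon
    (O : EuclideanSpace ℝ (Fin 2)) (r : ℝ) (hr : 0 < r)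
    (A B C D E F : EuclideanSpace ℝ (Fin 2))
    (hA : A ∈ Metric.sphere O r) (hB : B ∈ Metric.sphere O r)
    (hC : C ∈ Metric.sphere O r) (hD : D ∈ Metric.sphere O r)
    (hE : E ∈ Metric.sphere O r) (hF : F ∈ Metric.sphere O r)
    (hdist : Function.Injective ![A, B, C, D, E, F])
    (X Y Z : EuclideanSpace ℝ (Fin 2))
    (hX₁ : X ∈ affineSpan ℝ ({A, B} : Set (EuclideanSpace ℝ (Fin 2))))
    (hX₂ : X ∈ affineSpan ℝ ({D, E} : Set (EuclideanSpace ℝ (Fin 2))))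
    (hY₁ : Y ∈ affineSpan ℝ ({B, C} : Set (EuclideanSpace ℝ (Fin 2))))
    (hY₂ : Y ∈ affineSpan ℝ ({E, F} : Set (EuclideanSpace ℝ (Fin 2))))
    (hZ₁ : Z ∈ affineSpan ℝ ({C, D} : Set (EuclideanSpace ℝ (Fin 2))))
    (hZ₂ : Z ∈ affineSpan ℝ ({F, A} : Set (EuclideanSpace ℝ (Fin 2)))) :
    Collinear ℝ ({X, Y, Z} : Set (EuclideanSpace ℝ (Fin 2))) := by
  have hne : ∀ i j : Fin 6, i ≠ j → circleCoord O r (![A, B, C, D, E, F] i) ≠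
      circleCoord O r (![A, B, C, D, E, F] j) :=
    fun i j hij h => hij (hdist (circleCoord_injective O hr h))
  have x₁ := circleCoord_chord_equation hr hA hB hX₁
  have x₂ := circleCoord_chord_equation hr hD hE hX₂
  have y₁ := circleCoord_chord_equation hr hB hC hY₁
  have y₂ := circleCoord_chord_equation hr hE hF hY₂
  have z₁ := circleCoord_chord_equation hr hC hD hZ₁
  have z₂ := circleCoord_chord_equation hr hF hA hZ₂
  have hdet := pascal_determinant
    (mul_ne_mul_of_chord_equations (hne 0 3 (by decide)) (hne 0 4 (by decide)) x₁ x₂)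
    (mul_ne_mul_of_chord_equations (hne 1 4 (by decide)) (hne 1 5 (by decide)) y₁ y₂)
    (mul_ne_mul_of_chord_equations (hne 2 5 (by decide)) (hne 2 0 (by decide)) z₁ z₂)
    x₁ x₂ y₁ y₂ z₁ z₂
  have him := congrArg Complex.im hdet
  simp [circleCoord] at him
  field_simp at him
  apply collinear_of_det_eq_zero
  linear_combination (-1 / 2) * him
end

section
/- (Möbius, 1847) Let n ≥ 1 and let A₁, A₂, …, A₍₄ₙ₊₂₎ be pairwise distinct points lying on a circle in the Euclidean plane ℝ², with indices taken modulo 4n+2. For each i = 1, …, 2n+1, let Xᵢ be a point lying on both the line through Aᵢ and Aᵢ₊₁ and the line through Aᵢ₊₂ₙ₊₁ and Aᵢ₊₂ₙ₊₂ (these are a pair of opposite sides of the (4n+2)-gon). If the points X₁, …, X₂ₙ all lie on a common line ℓ, then X₂ₙ₊₁ also lies on ℓ. -/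
open ComplexConjugate

/-- For points `z, w, u, v` of the unit circle, this vanishes iff the chords `zw` and `uv` meet
the line `re = h` in the same (possibly infinite) point. -/
def chordDet {K : Type*} [CommRing K] (h z w u v : K) : K :=
  (z * w - 1) * (2 * h - u - v) - (u * v - 1) * (2 * h - z - w)

/-- An algebraic form of Pascal's theorem. -/
theorem chordDet_pascal {K : Type*} [Field K] {h a₁ a₂ a₃ b₁ b₂ b₃ : K}
    (ha : a₂ ^ 2 - 2 * h * a₂ + 1 ≠ 0) (hb : b₂ ^ 2 - 2 * h * b₂ + 1 ≠ 0)
    (h₁ : chordDet h a₁ a₂ b₁ b₂ = 0) (h₂ : chordDet h a₂ a₃ b₂ b₃ = 0) :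
    chordDet h a₁ b₃ b₁ a₃ = 0 := by
  have key : (a₂ ^ 2 - 2 * h * a₂ + 1) * (b₂ ^ 2 - 2 * h * b₂ + 1) * chordDet h a₁ b₃ b₁ a₃
      = 0 := by
    unfold chordDet at *
    linear_combination
      ((b₂ * b₃ - 1) * (a₂ * a₃ - 1) + 2 * h * (b₂ * b₃ - 1) * (2 * h - a₂ - a₃)
        + (2 * h - b₂ - b₃) * (2 * h - a₂ - a₃)) * h₁
      - ((a₁ * a₂ - 1) * (b₁ * b₂ - 1) + (2 * h - a₁ - a₂) * (2 * h - b₁ - b₂)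
        + 2 * h * (2 * h - a₁ - a₂) * (b₁ * b₂ - 1)) * h₂
  exact (mul_eq_zero.mp key).resolve_left (mul_ne_zero ha hb)

theorem chordDet_swap {K : Type*} [CommRing K] {h z w u v : K}
    (H : chordDet h z w u v = 0) : chordDet h u v z w = 0 := by
  unfold chordDet at *
  linear_combination -H

theorem chordDet_chain {K : Type*} [Field K] {h : K} {a b : ℕ → K} {N : ℕ}
    (hab : ∀ i, 1 ≤ i → i < N → chordDet h (a i) (a (i + 1)) (b i) (b (i + 1)) = 0)
    (ha : ∀ i, 2 ≤ i → i < N → a i ^ 2 - 2 * h * a i + 1 ≠ 0)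
    (hb : ∀ i, 2 ≤ i → i < N → b i ^ 2 - 2 * h * b i + 1 ≠ 0) {m : ℕ} (hm : 2 ≤ m) :
    m ≤ N → (Even m → chordDet h (a 1) (a m) (b 1) (b m) = 0) ∧
      (Odd m → chordDet h (a 1) (b m) (b 1) (a m) = 0) := by
  induction m, hm using Nat.le_induction with
  | base => exact fun hN => ⟨fun _ => hab 1 le_rfl hN, fun h₂ => absurd h₂ (by decide)⟩
  | succ m hm ih =>
    intro hN
    have hstep := hab m (by omega) hN
    obtain ⟨ih₁, ih₂⟩ := ih (by omega)
    constructor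
    · intro hev
      have hodd : Odd m := by
        rw [Nat.even_add_one] at hev
        exact Nat.not_even_iff_odd.mp hev
      exact chordDet_pascal (hb m hm hN) (ha m hm hN) (ih₂ hodd) (chordDet_swap hstep)
    · intro hodd
      have hev : Even m := by
        rw [Nat.odd_add_one] at hodd
        exact Nat.not_odd_iff_even.mp hodd
      exact chordDet_pascal (ha m hm hN) (hb m hm hN) (ih₁ hev) hstep

theorem Complex.conj_eq_two_mul_re_sub (x : ℂ) : conj x = 2 * (x.re : ℂ) - x := by
  apply Complex.ext <;> simp
  ring

/-- If `X` lies on the chords `zw` and `uv` of the unit circle, it is not on the circle, so the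
vertical line through `X` contains `z` only if `w = z⁻¹`. -/
theorem mul_eq_one_of_chords {h : ℝ} {z w u v X : ℂ} (hz : z * conj z = 1)
    (hX₁ : X + z * w * conj X = z + w) (hX₂ : X + u * v * conj X = u + v)
    (hu : z ≠ u) (hv : z ≠ v) (hXh : X.re = h) (hq : z ^ 2 - 2 * (h : ℂ) * z + 1 = 0) :
    z * w = 1 := by
  have hz0 : z ≠ 0 := by
    rintro rfl
    simp at hz
  have hzc : conj z = 2 * (h : ℂ) - z := by
    apply mul_left_cancel₀ hz0
    linear_combination hz + hq
  have hXc : conj X = 2 * (h : ℂ) - X := by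
    rw [Complex.conj_eq_two_mul_re_sub, hXh]
  have hne : X - z ≠ 0 := by
    intro h0
    have hXz : X = z := sub_eq_zero.mp h0
    rw [hXz] at hX₂
    have : (z - u) * (z - v) = 0 := by
      linear_combination z * hX₂ - u * v * hz
    rcases mul_eq_zero.mp this with h1 | h1
    · exact hu (sub_eq_zero.mp h1)
    · exact hv (sub_eq_zero.mp h1)
  apply mul_left_cancel₀ hne
  rw [hXc] at hX₁
  rw [hzc] at hz
  linear_combination -hX₁ + w * hz

theorem chordDet_eq_zero_of_re_eq {h : ℝ} {z w u v X : ℂ}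
    (hX₁ : X + z * w * conj X = z + w) (hX₂ : X + u * v * conj X = u + v)
    (hXh : X.re = h) : chordDet (h : ℂ) z w u v = 0 := by
  rw [Complex.conj_eq_two_mul_re_sub, hXh] at hX₁ hX₂
  unfold chordDet
  linear_combination (u * v - 1) * hX₁ * (-1) + (z * w - 1) * hX₂

theorem re_eq_of_chordDet_eq_zero {h : ℝ} {z w u v X : ℂ}
    (hX₁ : X + z * w * conj X = z + w) (hX₂ : X + u * v * conj X = u + v)
    (hu : z ≠ u) (hv : z ≠ v) (hE : chordDet (h : ℂ) z w u v = 0) : X.re = h := by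
  rw [Complex.conj_eq_two_mul_re_sub] at hX₁ hX₂
  have hmul : ((h : ℂ) - X.re) * (z * w - u * v) = 0 := by
    unfold chordDet at hE
    linear_combination (hE + (u * v - 1) * hX₁ - (z * w - 1) * hX₂) / 2
  rcases mul_eq_zero.mp hmul with h0 | h0
  · exact_mod_cast (sub_eq_zero.mp h0).symm
  · exfalso
    have : (z - u) * (z - v) = 0 := by
      linear_combination z * (hX₂ - hX₁) + (z * (2 * (X.re : ℂ) - X) - 1) * h0
    rcases mul_eq_zero.mp this with h1 | h1
    · exact hu (sub_eq_zero.mp h1)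
    · exact hv (sub_eq_zero.mp h1)

/-- Möbius's theorem for the unit circle in `ℂ` and a vertical line. -/
theorem moebius_pascal_unit_circle {n : ℕ} (hn : 1 ≤ n) {y : ℕ → ℂ}
    (hy : ∀ k, y k * conj (y k) = 1) (hper : ∀ k, y (k + (4 * n + 2)) = y k)
    (hinj : ∀ k l, y k = y l → k % (4 * n + 2) = l % (4 * n + 2)) {X : ℕ → ℂ} {h : ℝ}
    (hX₁ : ∀ i, 1 ≤ i → i ≤ 2 * n + 1 →
      X i + y i * y (i + 1) * conj (X i) = y i + y (i + 1))
    (hX₂ : ∀ i, 1 ≤ i → i ≤ 2 * n + 1 →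
      X i + y (i + (2 * n + 1)) * y (i + (2 * n + 2)) * conj (X i)
        = y (i + (2 * n + 1)) + y (i + (2 * n + 2)))
    (hXh : ∀ i, 1 ≤ i → i ≤ 2 * n → (X i).re = h) : (X (2 * n + 1)).re = h := by
  have hne : ∀ k l, k < l → l < k + (4 * n + 2) → y k ≠ y l := by
    intro k l hkl hlk heq
    have h1 : k ≡ l [MOD 4 * n + 2] := hinj k l heq
    have h2 := Nat.le_of_dvd (by omega) ((Nat.modEq_iff_dvd' hkl.le).mp h1)
    omega
  have hcancel : ∀ k a b, y k * a = 1 → y k * b = 1 → a = b := by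
    intro k a b ha hb
    have h0 : y k ≠ 0 := left_ne_zero_of_mul_eq_one ha
    exact mul_left_cancel₀ h0 (ha.trans hb.symm)
  have hlow : ∀ i, 2 ≤ i → i < 2 * n + 1 → y i ^ 2 - 2 * (h : ℂ) * y i + 1 ≠ 0 := by
    intro i hi hin hq
    obtain ⟨j, rfl⟩ : ∃ j, i = j + 1 := ⟨i - 1, by omega⟩
    have e₁ := mul_eq_one_of_chords (hy (j + 1)) (hX₁ (j + 1) (by omega) (by omega))
      (hX₂ (j + 1) (by omega) (by omega)) (hne _ _ (by omega) (by omega))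
      (hne _ _ (by omega) (by omega)) (hXh (j + 1) (by omega) (by omega)) hq
    have hprev := hX₁ j (by omega) (by omega)
    rw [mul_comm (y j), add_comm (y j)] at hprev
    have e₂ := mul_eq_one_of_chords (hy (j + 1)) hprev
      (hX₂ j (by omega) (by omega)) (hne _ _ (by omega) (by omega))
      (hne _ _ (by omega) (by omega)) (hXh j (by omega) (by omega)) hq
    exact hne j (j + 1 + 1) (by omega) (by omega) (hcancel _ _ _ e₂ e₁)
  have hhigh : ∀ i, 2 ≤ i → i < 2 * n + 1 →
      y (i + (2 * n + 1)) ^ 2 - 2 * (h : ℂ) * y (i + (2 * n + 1)) + 1 ≠ 0 := by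
    intro i hi hin hq
    obtain ⟨j, rfl⟩ : ∃ j, i = j + 1 := ⟨i - 1, by omega⟩
    have e₁ := mul_eq_one_of_chords (hy _) (hX₂ (j + 1) (by omega) (by omega))
      (hX₁ (j + 1) (by omega) (by omega)) (hne _ _ (by omega) (by omega)).symm
      (hne _ _ (by omega) (by omega)).symm (hXh (j + 1) (by omega) (by omega)) hq
    have hprev := hX₂ j (by omega) (by omega)
    rw [show j + (2 * n + 2) = j + 1 + (2 * n + 1) by ring, mul_comm (y (j + (2 * n + 1))),
      add_comm (y (j + (2 * n + 1)))] at hprev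
    have e₂ := mul_eq_one_of_chords (hy _) hprev
      (hX₁ j (by omega) (by omega)) (hne _ _ (by omega) (by omega)).symm
      (hne _ _ (by omega) (by omega)).symm (hXh j (by omega) (by omega)) hq
    exact hne _ _ (by omega) (by omega) (hcancel _ _ _ e₂ e₁)
  have hE := (chordDet_chain (h := (h : ℂ)) (a := y) (b := fun i => y (i + (2 * n + 1)))
    (N := 2 * n + 1) (m := 2 * n + 1)
    (fun i hi hiN => by
      have := chordDet_eq_zero_of_re_eq (hX₁ i hi hiN.le) (hX₂ i hi hiN.le)
        (hXh i hi (by omega))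
      rwa [show i + (2 * n + 2) = i + 1 + (2 * n + 1) by ring] at this)
    hlow hhigh (by omega) le_rfl).2 ⟨n, rfl⟩
  have hlast₁ := hX₁ (2 * n + 1) (by omega) le_rfl
  have hlast₂ := hX₂ (2 * n + 1) (by omega) le_rfl
  rw [show 2 * n + 1 + (2 * n + 2) = 1 + (4 * n + 2) by ring, hper] at hlast₂
  rw [show 2 * n + 1 + 1 = 1 + (2 * n + 1) by ring] at hlast₁
  refine re_eq_of_chordDet_eq_zero hlast₁ hlast₂ (hne _ _ (by omega) (by omega))
    (hne 1 _ (by omega) (by omega)).symm ?_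
  unfold chordDet at hE ⊢
  linear_combination -hE

/-- A point of the line through two points of the unit circle satisfies the chord equation. -/
theorem chord_equation_s1 {z w X : ℂ} {t : ℝ} (hz : z * conj z = 1) (hw : w * conj w = 1)
    (hX : X = z + t * (w - z)) : X + z * w * conj X = z + w := by
  rw [hX]
  simp only [map_add, map_mul, map_sub, Complex.conj_ofReal]
  linear_combination w * (1 - t) * hz + z * t * hw

/-- Complex coordinates in which a given circle is the unit circle and a given line is vertical. -/
theorem exists_complex_coordinates {O : EuclideanSpace ℝ (Fin 2)} {r : ℝ} (hr : 0 < r)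
    {ℓ : AffineSubspace ℝ (EuclideanSpace ℝ (Fin 2))}
    (hℓ : Module.finrank ℝ ℓ.direction = 1) {Q : EuclideanSpace ℝ (Fin 2)} (hQ : Q ∈ ℓ) :
    ∃ f : EuclideanSpace ℝ (Fin 2) →ᵃ[ℝ] ℂ, Function.Injective f ∧
      (∀ P ∈ Metric.sphere O r, f P * conj (f P) = 1) ∧
      ∀ P, P ∈ ℓ ↔ (f P).re = (f Q).re := by
  obtain ⟨⟨v, hvℓ⟩, hv0, hv⟩ := finrank_eq_one_iff'.mp hℓ
  let e : EuclideanSpace ℝ (Fin 2) ≃ₗᵢ[ℝ] ℂ := Complex.orthonormalBasisOneI.repr.symm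
  have hδ : e v ≠ 0 := by
    intro h0
    exact hv0 (Subtype.ext (e.map_eq_zero_iff.mp h0))
  have hδn : ‖e v‖ ≠ 0 := norm_ne_zero_iff.mpr hδ
  let s : ℝ := (r * ‖e v‖)⁻¹
  have hs : 0 < s := by positivity
  let κ : ℂ := s * (Complex.I * conj (e v))
  have hκ : ‖κ‖ = r⁻¹ := by
    simp only [κ, norm_mul, Complex.norm_real, Complex.norm_I, RCLike.norm_conj, one_mul,
      Real.norm_of_nonneg hs.le]
    simp only [s]
    field_simp
  have hκ0 : κ ≠ 0 := norm_ne_zero_iff.mp (by rw [hκ]; positivity)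
  let L : EuclideanSpace ℝ (Fin 2) →ₗ[ℝ] ℂ :=
    LinearMap.mulLeft ℝ κ ∘ₗ (e.toLinearEquiv : EuclideanSpace ℝ (Fin 2) →ₗ[ℝ] ℂ)
  have hL : ∀ P, L P = κ * e P := fun _ => rfl
  let f : EuclideanSpace ℝ (Fin 2) →ᵃ[ℝ] ℂ := L.toAffineMap - AffineMap.const ℝ _ (L O)
  have hf : ∀ P, f P = κ * e (P - O) := fun P => by
    rw [← hL, map_sub]
    rfl
  refine ⟨f, fun P P' hP => ?_, fun P hP => ?_, fun P => ?_⟩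
  · rw [hf, hf] at hP
    exact sub_left_injective (e.injective (mul_left_cancel₀ hκ0 hP))
  · have hnorm : ‖f P‖ = 1 := by
      rw [hf, norm_mul, hκ, e.norm_map, mem_sphere_iff_norm.mp hP, inv_mul_cancel₀ hr.ne']
    rw [Complex.mul_conj, Complex.normSq_eq_norm_sq, hnorm]
    simp
  · have hre : (f P).re - (f Q).re = -s * (conj (e v) * e (P - Q)).im := by
      rw [← Complex.sub_re, hf, hf, ← mul_sub, ← map_sub, sub_sub_sub_cancel_right,
        show κ * e (P - Q) = s * (Complex.I * (conj (e v) * e (P - Q))) by simp only [κ]; ring,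
        Complex.re_ofReal_mul, Complex.I_mul_re]
      ring
    rw [← AffineSubspace.vsub_right_mem_direction_iff_mem hQ, ← sub_eq_zero (b := (f Q).re), hre,
      vsub_eq_sub]
    constructor
    · intro hPQ
      obtain ⟨c, hc⟩ := hv ⟨_, hPQ⟩
      have hc' : P - Q = c • v := (congrArg Subtype.val hc).symm
      rw [hc', map_smul, mul_smul_comm, mul_comm (conj (e v)), Complex.mul_conj]
      simp
    · intro him
      have him' := (mul_eq_zero.mp him).resolve_left (neg_ne_zero.mpr hs.ne')
      have hreal : conj (e v) * e (P - Q) = ((conj (e v) * e (P - Q)).re : ℂ) :=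
        Complex.ext rfl him'
      set c : ℝ := (conj (e v) * e (P - Q)).re
      have hPQ : ‖e v‖ ^ 2 • (P - Q) = c • v := by
        apply e.injective
        rw [map_smul, map_smul, Complex.real_smul, Complex.real_smul, ← hreal,
          ← Complex.normSq_eq_norm_sq, ← Complex.mul_conj]
        ring
      have hPQ' : P - Q = ((‖e v‖ ^ 2)⁻¹ * c) • v := by
        rw [mul_smul, ← hPQ, inv_smul_smul₀ (pow_ne_zero 2 hδn)]
      rw [hPQ']
      exact ℓ.direction.smul_mem _ hvℓ

/-- **Möbius's generalization of Pascal's theorem (1847).** Let `A 1, …, A (4n+2)` be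
pairwise distinct points on a circle in the Euclidean plane, indices taken modulo `4n+2`.
For `i = 1, …, 2n+1`, let `X i` be a point on both the line through `A i` and `A (i+1)`
and the line through `A (i+2n+1)` and `A (i+2n+2)`. If `X 1, …, X (2n)` all lie on a
common line `ℓ`, then `X (2n+1) ∈ ℓ`. -/
theorem moebius_pascal
    (n : ℕ) (hn : 1 ≤ n)
    (O : EuclideanSpace ℝ (Fin 2)) (r : ℝ) (hr : 0 < r)
    (A : ZMod (4 * n + 2) → EuclideanSpace ℝ (Fin 2))
    (hA : ∀ i, A i ∈ Metric.sphere O r)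
    (hdist : Function.Injective A)
    (X : ℕ → EuclideanSpace ℝ (Fin 2))
    (hX₁ : ∀ i ∈ Finset.Icc 1 (2 * n + 1),
      X i ∈ affineSpan ℝ ({A (i : ZMod (4 * n + 2)), A ((i : ZMod (4 * n + 2)) + 1)} :
        Set (EuclideanSpace ℝ (Fin 2))))
    (hX₂ : ∀ i ∈ Finset.Icc 1 (2 * n + 1),
      X i ∈ affineSpan ℝ
        ({A ((i : ZMod (4 * n + 2)) + (2 * n + 1 : ℕ)),
          A ((i : ZMod (4 * n + 2)) + (2 * n + 2 : ℕ))} : Set (EuclideanSpace ℝ (Fin 2))))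
    (ℓ : AffineSubspace ℝ (EuclideanSpace ℝ (Fin 2)))
    (hℓ : Module.finrank ℝ ℓ.direction = 1)
    (hXℓ : ∀ i ∈ Finset.Icc 1 (2 * n), X i ∈ ℓ) :
    X (2 * n + 1) ∈ ℓ := by
  obtain ⟨f, hf, hfO, hfℓ⟩ := exists_complex_coordinates (O := O) hr hℓ
    (hXℓ 1 (Finset.mem_Icc.mpr ⟨le_rfl, by omega⟩))
  have hchord : ∀ j k P, P ∈ affineSpan ℝ ({A j, A k} : Set (EuclideanSpace ℝ (Fin 2))) →
      f P + f (A j) * f (A k) * conj (f P) = f (A j) + f (A k) := by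
    intro j k P hP
    obtain ⟨t, rfl⟩ := mem_affineSpan_pair_iff_exists_lineMap_eq.mp hP
    refine chord_equation_s1 (t := t) (hfO _ (hA j)) (hfO _ (hA k)) ?_
    rw [AffineMap.apply_lineMap, AffineMap.lineMap_apply]
    simp [add_comm]
  rw [hfℓ]
  refine moebius_pascal_unit_circle (X := fun i => f (X i)) hn
    (y := fun k => f (A (k : ZMod (4 * n + 2)))) (fun k => hfO _ (hA _)) (fun k => ?_)
    (fun k l hkl => ?_) (fun i hi hin => ?_) (fun i hi hin => ?_) (fun i hi hin => ?_)
  · simp only [Nat.cast_add k, ZMod.natCast_self, add_zero]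
  · exact (ZMod.natCast_eq_natCast_iff' _ _ _).mp (hdist (hf hkl))
  · have := hchord _ _ _ (hX₁ i (Finset.mem_Icc.mpr ⟨hi, hin⟩))
    simpa only [Nat.cast_add i, Nat.cast_one] using this
  · have := hchord _ _ _ (hX₂ i (Finset.mem_Icc.mpr ⟨hi, hin⟩))
    simpa only [Nat.cast_add i] using this
  · exact (hfℓ _).mp (hXℓ i (Finset.mem_Icc.mpr ⟨hi, hin⟩))
end
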